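/- At any solution of NHAD-LCP, each agent receives an optimal bundle of goods with respect to the prices p = p' + c: for every agent i, the bundle given by x^i_j := ∑_k q^i_{jk}/(p'_j + c_j) maximizes U^i among all bundles whose cost at prices p is at most i's budget ∑_j w^i_j p_j + ∑_f θ^i_f E^f. -/

import Mathlib

open scoped Classical

noncomputable section

/-- An SPLC market: finitely many goods `G`, agents `A`, and firms `F`;
endowments `w`, firm ownership shares `θ`, firm `f` produces good `jf f`;
agent `i`'s utility for good `j` is SPLC with `numU i j` segments of slopes `u i j k`
and lengths `l i j k` (`k < numU i j`); firm `f`'s production of good `jf f` from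
raw good `j` is SPLC with `numP f j` segments of slopes `α f j k` and lengths `o f j k`. -/
structure SPLCMarket where
  (G A F : Type)
  [instG : Fintype G]
  [instA : Fintype A]
  [instF : Fintype F]
  (w : A → G → ℝ)
  (w_nonneg : ∀ i j, 0 ≤ w i j)
  (w_sum : ∀ j, ∑ i, w i j = 1)
  (jf : F → G)
  (θ : A → F → ℝ)
  (θ_nonneg : ∀ i f, 0 ≤ θ i f)
  (θ_sum : ∀ f, ∑ i, θ i f = 1)
  (numU : A → G → ℕ)
  (numU_pos : ∀ i j, 0 < numU i j)
  (u : A → G → ℕ → ℝ)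
  (l : A → G → ℕ → ℝ)
  (u_nonneg : ∀ i j k, k < numU i j → 0 ≤ u i j k)
  (l_pos : ∀ i j k, k < numU i j → 0 < l i j k)
  (u_anti : ∀ i j k, k + 1 < numU i j → u i j (k + 1) < u i j k)
  (numP : F → G → ℕ)
  (numP_pos : ∀ f j, 0 < numP f j)
  (α : F → G → ℕ → ℝ)
  (o : F → G → ℕ → ℝ)
  (α_nonneg : ∀ f j k, k < numP f j → 0 ≤ α f j k)
  (o_pos : ∀ f j k, k < numP f j → 0 < o f j k)
  (α_anti : ∀ f j k, k + 1 < numP f j → α f j (k + 1) < α f j k)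

attribute [instance] SPLCMarket.instG SPLCMarket.instA SPLCMarket.instF

namespace SPLCMarket

variable (M : SPLCMarket)

/-- A segment-indexed allocation: nonnegative, within segment lengths, zero beyond
the actual segments. -/
def IsSegAlloc (num : M.G → ℕ) (len : M.G → ℕ → ℝ) (x : M.G → ℕ → ℝ) : Prop :=
  ∀ j k, 0 ≤ x j k ∧ (k < num j → x j k ≤ len j k) ∧ (num j ≤ k → x j k = 0)

/-- A production plan of firm `f`: amounts of raw goods used on each segment. -/
def IsPlan (f : M.F) (x : M.G → ℕ → ℝ) : Prop :=
  M.IsSegAlloc (M.numP f) (M.o f) x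

/-- Profit of plan `x` of firm `f` at prices `p`. -/
def planProfit (f : M.F) (p : M.G → ℝ) (x : M.G → ℕ → ℝ) : ℝ :=
  ∑ j, ∑ k ∈ Finset.range (M.numP f j), x j k * (M.α f j k * p (M.jf f) - p j)

/-- Amount of good `jf f` produced by plan `x` of firm `f`. -/
def planOutput (f : M.F) (x : M.G → ℕ → ℝ) : ℝ :=
  ∑ j, ∑ k ∈ Finset.range (M.numP f j), M.α f j k * x j k

/-- A profit-maximizing production plan. -/
def OptimalPlan (f : M.F) (p : M.G → ℝ) (x : M.G → ℕ → ℝ) : Prop :=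
  M.IsPlan f x ∧ ∀ x', M.IsPlan f x' → M.planProfit f p x' ≤ M.planProfit f p x

/-- Amount allocated to segment `k` when an amount `t` is filled greedily along
segments of lengths `len 0, len 1, …`. -/
def segAmt (len : ℕ → ℝ) (k : ℕ) (t : ℝ) : ℝ :=
  max 0 (min (len k) (t - ∑ k' ∈ Finset.range k, len k'))

/-- The (separable piecewise-linear concave) utility of agent `i` for bundle `x`. -/
def utilFn (i : M.A) (x : M.G → ℝ) : ℝ :=
  ∑ j, ∑ k ∈ Finset.range (M.numU i j), M.u i j k * segAmt (M.l i j) k (x j)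

/-- Utility of a segment-indexed allocation of agent `i`. -/
def segUtility (i : M.A) (x : M.G → ℕ → ℝ) : ℝ :=
  ∑ j, ∑ k ∈ Finset.range (M.numU i j), M.u i j k * x j k

/-- Cost of bundle `x` at prices `p`. -/
def bundleCost (p : M.G → ℝ) (x : M.G → ℝ) : ℝ := ∑ j, p j * x j

/-- `x` is an optimal (budget-constrained utility-maximizing) bundle for agent `i`. -/
def OptimalBundleAmt (i : M.A) (p : M.G → ℝ) (B : ℝ) (x : M.G → ℝ) : Prop :=
  (∀ j, 0 ≤ x j) ∧ M.bundleCost p x ≤ B ∧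
    ∀ y : M.G → ℝ, (∀ j, 0 ≤ y j) → M.bundleCost p y ≤ B → M.utilFn i y ≤ M.utilFn i x

/-- A segment-indexed optimal bundle for agent `i`: affordable, and its utility is at
least that of any affordable bundle. -/
def OptimalBundle (i : M.A) (p : M.G → ℝ) (B : ℝ) (x : M.G → ℕ → ℝ) : Prop :=
  M.IsSegAlloc (M.numU i) (M.l i) x ∧
  M.bundleCost p (fun j => ∑ k ∈ Finset.range (M.numU i j), x j k) ≤ B ∧
  ∀ y : M.G → ℝ, (∀ j, 0 ≤ y j) → M.bundleCost p y ≤ B → M.utilFn i y ≤ M.segUtility i x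

/-- Budget of agent `i` at prices `p` when firms' (maximum) profits are `E`. -/
def budget (i : M.A) (p : M.G → ℝ) (E : M.F → ℝ) : ℝ :=
  ∑ j, M.w i j * p j + ∑ f, M.θ i f * E f

/-- Market equilibrium: nonnegative prices, profit-maximizing plans (with `E f` the
maximum profit of firm `f`), optimal bundles, and market clearing for every good. -/
def IsEquilibrium (p : M.G → ℝ) (xF : M.F → M.G → ℕ → ℝ) (xA : M.A → M.G → ℕ → ℝ)
    (E : M.F → ℝ) : Prop :=
  (∀ j, 0 ≤ p j) ∧
  (∀ f, M.OptimalPlan f p (xF f) ∧ E f = M.planProfit f p (xF f)) ∧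
  (∀ i, M.OptimalBundle i p (M.budget i p E) (xA i)) ∧
  (∀ j, (∑ i, ∑ k ∈ Finset.range (M.numU i j), xA i j k)
      + (∑ f, ∑ k ∈ Finset.range (M.numP f j), xF f j k)
      = 1 + ∑ f, if M.jf f = j then M.planOutput f (xF f) else 0)

/-- No production out of nothing: along every cyclic sequence of (first segments of)
productions, the rates multiply to strictly less than `1`. -/
def NoProductionOutOfNothing : Prop :=
  ∀ (m : ℕ) (fs : Fin (m + 1) → M.F) (gs : Fin (m + 1) → M.G),
    (∀ t, 0 < M.α (fs t) (gs t) 0) → (∀ t, M.jf (fs t) = gs (t + 1)) →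
    ∏ t, M.α (fs t) (gs t) 0 < 1

/-- Total amount of good `j` represented by agents' segments with positive slope. -/
def desire (j : M.G) : ℝ :=
  ∑ i, ∑ k ∈ (Finset.range (M.numU i j)).filter (fun k => 0 < M.u i j k), M.l i j k

def EnoughDemand : Prop := ∀ j, 1 < M.desire j

/-- A node (agent or firm) possesses/produces good `j`. -/
def owns : M.A ⊕ M.F → M.G → Prop
  | Sum.inl i, j => 0 < M.w i j
  | Sum.inr f, j => M.jf f = j

/-- A node (agent or firm) is non-satiated by good `j`: its last segment for `j`
has positive slope. -/
def nonsat : M.A ⊕ M.F → M.G → Prop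
  | Sum.inl i, j => 0 < M.u i j (M.numU i j - 1)
  | Sum.inr f, j => 0 < M.α f j (M.numP f j - 1)

/-- Edge of the graph `G(M)`. -/
def edge (a b : M.A ⊕ M.F) : Prop := ∃ j, M.owns a j ∧ M.nonsat b j

/-- Strong connectivity: all agent nodes lie in one strongly connected component of `G(M)`. -/
def StrongConnectivity : Prop :=
  ∀ i i' : M.A, Relation.ReflTransGen M.edge (Sum.inl i) (Sum.inl i')

/-- The largest production slope (or `0`). -/
def αmax : ℝ := sSup (insert 0 {x | ∃ f j k, k < M.numP f j ∧ M.α f j k = x})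

/-- The smallest positive production slope. -/
def αminpos : ℝ := sInf {x | 0 < x ∧ ∃ f j k, k < M.numP f j ∧ M.α f j k = x}

/-- The safe bound `L = n^n (α_max + 1)^n`. -/
def Lbig : ℝ :=
  (Fintype.card M.G : ℝ) ^ (Fintype.card M.G) * (M.αmax + 1) ^ (Fintype.card M.G)

/-- Lengths of last segments are fixed to the safe values. -/
def SafeLengths : Prop :=
  (∀ f j, M.o f j (M.numP f j - 1) = M.Lbig / max 1 M.αminpos) ∧
  (∀ i j, M.l i j (M.numU i j - 1) = M.Lbig + 1)

/-- Revenue from production of good `j`: `∑_{f : jf f = j} ∑_{j',k} s^f_{j'k}`,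
where `s^f_{jk} = r^f_{jk} + o^f_{jk} β^f_{jk}`. -/
def prodRevenue (r β : M.F → M.G → ℕ → ℝ) (j : M.G) : ℝ :=
  ∑ f, if M.jf f = j then
      ∑ j', ∑ k ∈ Finset.range (M.numP f j'), (r f j' k + M.o f j' k * β f j' k)
    else 0

/-- The profit `E^f = ∑_{j,k} o^f_{jk} β^f_{jk}` of firm `f` in the LCP. -/
def lcpProfit (β : M.F → M.G → ℕ → ℝ) (f : M.F) : ℝ :=
  ∑ j, ∑ k ∈ Finset.range (M.numP f j), M.o f j k * β f j k

/-- The common core of AD-LCP, NHAD-LCP and NHAD-LCP': all constraints and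
complementarity conditions, with prices `p`, good-clearing complementarity multiplier
`pc`, and `zsub` subtracted in the agents' constraints. -/
def LCPCore (lam : M.A → ℝ) (p pc : M.G → ℝ) (q γ : M.A → M.G → ℕ → ℝ)
    (r β : M.F → M.G → ℕ → ℝ) (zsub : ℝ) : Prop :=
  (∀ i, 0 ≤ lam i) ∧
  (∀ i j k, 0 ≤ q i j k ∧ 0 ≤ γ i j k ∧ (M.numU i j ≤ k → q i j k = 0 ∧ γ i j k = 0)) ∧
  (∀ f j k, 0 ≤ r f j k ∧ 0 ≤ β f j k ∧ (M.numP f j ≤ k → r f j k = 0 ∧ β f j k = 0)) ∧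
  (∀ f j k, k < M.numP f j →
    M.α f j k * p (M.jf f) - p j ≤ β f j k ∧
    r f j k * (M.α f j k * p (M.jf f) - p j - β f j k) = 0) ∧
  (∀ f j k, k < M.numP f j →
    r f j k ≤ M.o f j k * p j ∧ β f j k * (r f j k - M.o f j k * p j) = 0) ∧
  (∀ j, (∑ i, ∑ k ∈ Finset.range (M.numU i j), q i j k)
      + (∑ f, ∑ k ∈ Finset.range (M.numP f j), r f j k)
      ≤ p j + M.prodRevenue r β j ∧
    pc j * ((∑ i, ∑ k ∈ Finset.range (M.numU i j), q i j k)
      + (∑ f, ∑ k ∈ Finset.range (M.numP f j), r f j k)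
      - p j - M.prodRevenue r β j) = 0) ∧
  (∀ i, (∑ j, M.w i j * p j) + (∑ f, M.θ i f * M.lcpProfit β f)
      - (∑ j, ∑ k ∈ Finset.range (M.numU i j), q i j k) - zsub ≤ 0 ∧
    lam i * ((∑ j, M.w i j * p j) + (∑ f, M.θ i f * M.lcpProfit β f)
      - (∑ j, ∑ k ∈ Finset.range (M.numU i j), q i j k) - zsub) = 0) ∧
  (∀ i j k, k < M.numU i j →
    M.u i j k * lam i ≤ p j + γ i j k ∧
    q i j k * (M.u i j k * lam i - p j - γ i j k) = 0) ∧
  (∀ i j k, k < M.numU i j →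
    q i j k ≤ M.l i j k * p j ∧ γ i j k * (q i j k - M.l i j k * p j) = 0)

/-- AD-LCP. -/
def ADLCP (lam : M.A → ℝ) (p : M.G → ℝ) (q γ : M.A → M.G → ℕ → ℝ)
    (r β : M.F → M.G → ℕ → ℝ) : Prop :=
  (∀ j, 0 ≤ p j) ∧ M.LCPCore lam p p q γ r β 0

/-- The vector `c` of price lower bounds: `c j > 1` and no segment has positive
profit at prices `c`. -/
def GoodPriceLB (c : M.G → ℝ) : Prop :=
  (∀ j, 1 < c j) ∧ ∀ f j k, k < M.numP f j → M.α f j k * c (M.jf f) < c j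

/-- NHAD-LCP: AD-LCP with `p j = p' j + c j`, the good-clearing complementarity
multiplier being `p'`. -/
def NHADLCP (c : M.G → ℝ) (lam : M.A → ℝ) (p' : M.G → ℝ) (q γ : M.A → M.G → ℕ → ℝ)
    (r β : M.F → M.G → ℕ → ℝ) : Prop :=
  (∀ j, 0 ≤ p' j) ∧ M.LCPCore lam (fun j => p' j + c j) p' q γ r β 0

/-- NHAD-LCP': NHAD-LCP augmented with the variable `z` in the agents' constraints. -/
def NHADLCP' (c : M.G → ℝ) (lam : M.A → ℝ) (p' : M.G → ℝ) (q γ : M.A → M.G → ℕ → ℝ)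
    (r β : M.F → M.G → ℕ → ℝ) (z : ℝ) : Prop :=
  (∀ j, 0 ≤ p' j) ∧ 0 ≤ z ∧ M.LCPCore lam (fun j => p' j + c j) p' q γ r β z

end SPLCMarket

namespace SPLCMarket

lemma sum_segAmt (len : ℕ → ℝ) {t : ℝ} (ht : 0 ≤ t) (m : ℕ) (hlen : ∀ k < m, 0 ≤ len k) :
    ∑ k ∈ Finset.range m, segAmt len k t = min t (∑ k ∈ Finset.range m, len k) := by
  induction m with
  | zero => simp [ht]
  | succ m ih =>
    rw [Finset.sum_range_succ, ih fun k hk => hlen k (hk.trans m.lt_succ_self),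
      Finset.sum_range_succ, segAmt]
    have hm := hlen m m.lt_succ_self
    grind

lemma segAmt_nonneg (len : ℕ → ℝ) (k : ℕ) (t : ℝ) : 0 ≤ segAmt len k t :=
  le_max_left _ _

lemma segAmt_le (len : ℕ → ℝ) (k : ℕ) (t : ℝ) (h : 0 ≤ len k) : segAmt len k t ≤ len k :=
  max_le h (min_le_left _ _)

/-- Abel summation: antitone weights applied to a sequence with nonnegative partial sums. -/
lemma mul_sum_le_sum_mul (u d : ℕ → ℝ) (m : ℕ) (hu : ∀ k, k + 1 < m → u (k + 1) ≤ u k)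
    (hd : ∀ k ≤ m, 0 ≤ ∑ k' ∈ Finset.range k, d k') (v : ℝ) (hv : ∀ k < m, v ≤ u k) :
    v * ∑ k ∈ Finset.range m, d k ≤ ∑ k ∈ Finset.range m, u k * d k := by
  induction m generalizing v with
  | zero => simp
  | succ m ih =>
    have hlast : ∀ k < m, u m ≤ u k := by
      intro k hk
      refine Nat.decreasingInduction' (P := fun k => u m ≤ u k) ?_ hk.le le_rfl
      exact fun j hj _ h => h.trans (hu j (by omega))
    have h1 := ih (fun k hk => hu k (by omega)) (fun k hk => hd k (by omega)) (u m) hlast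
    have h2 := mul_le_mul_of_nonneg_right (hv m m.lt_succ_self) (hd (m + 1) le_rfl)
    rw [Finset.sum_range_succ] at h2
    rw [Finset.sum_range_succ, Finset.sum_range_succ]
    linarith

/-- Filling segments greedily is at least as good as any other allocation of the same amount. -/
lemma sum_mul_le_sum_mul_segAmt (n : ℕ) (u len a : ℕ → ℝ) (hu0 : ∀ k < n, 0 ≤ u k)
    (hu : ∀ k, k + 1 < n → u (k + 1) ≤ u k) (ha0 : ∀ k < n, 0 ≤ a k)
    (ha : ∀ k < n, a k ≤ len k) :
    ∑ k ∈ Finset.range n, u k * a k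
      ≤ ∑ k ∈ Finset.range n, u k * segAmt len k (∑ k ∈ Finset.range n, a k) := by
  have hT : 0 ≤ ∑ k ∈ Finset.range n, a k :=
    Finset.sum_nonneg fun k hk => ha0 k (Finset.mem_range.1 hk)
  have key := mul_sum_le_sum_mul u
    (fun k => segAmt len k (∑ k ∈ Finset.range n, a k) - a k) n hu ?_ 0 hu0
  · simp only [zero_mul, mul_sub, Finset.sum_sub_distrib] at key
    linarith
  · intro m hm
    rw [Finset.sum_sub_distrib,
      sum_segAmt len hT m fun k hk => (ha0 k (by omega)).trans (ha k (by omega)), sub_nonneg]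
    refine le_min ?_ (Finset.sum_le_sum fun k hk => ha k ?_)
    · refine Finset.sum_le_sum_of_subset_of_nonneg (Finset.range_mono hm) fun k hk _ => ?_
      exact ha0 k (Finset.mem_range.1 hk)
    · exact (Finset.mem_range.1 hk).trans_le hm

variable {M : SPLCMarket}

lemma segUtility_le_utilFn (i : M.A) (a : M.G → ℕ → ℝ)
    (ha0 : ∀ j k, k < M.numU i j → 0 ≤ a j k)
    (ha : ∀ j k, k < M.numU i j → a j k ≤ M.l i j k) :
    M.segUtility i a ≤ M.utilFn i (fun j => ∑ k ∈ Finset.range (M.numU i j), a j k) :=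
  Finset.sum_le_sum fun j _ => sum_mul_le_sum_mul_segAmt _ _ _ _ (M.u_nonneg i j)
    (fun k hk => (M.u_anti i j k hk).le) (ha0 j) (ha j)

/-- Lagrangian bound on the utility of a bundle, with multipliers `lam` for the budget and `γ` for
the segment capacities. -/
lemma mul_utilFn_le (i : M.A) {lam : ℝ} {p y : M.G → ℝ} {γ : M.G → ℕ → ℝ}
    (hp : ∀ j, 0 ≤ p j) (hy : ∀ j, 0 ≤ y j)
    (hγ : ∀ j k, k < M.numU i j → 0 ≤ γ j k)
    (hdual : ∀ j k, k < M.numU i j → M.u i j k * lam ≤ p j + γ j k) :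
    lam * M.utilFn i y ≤ M.bundleCost p y
      + ∑ j, ∑ k ∈ Finset.range (M.numU i j), γ j k * M.l i j k := by
  rw [utilFn, bundleCost, Finset.mul_sum, ← Finset.sum_add_distrib]
  refine Finset.sum_le_sum fun j _ => ?_
  have hl := fun k hk => (M.l_pos i j k hk).le
  have hsum : ∑ k ∈ Finset.range (M.numU i j), segAmt (M.l i j) k (y j) ≤ y j :=
    (sum_segAmt (M.l i j) (hy j) _ hl).trans_le (min_le_left _ _)
  calc lam * ∑ k ∈ Finset.range (M.numU i j), M.u i j k * segAmt (M.l i j) k (y j)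
      ≤ ∑ k ∈ Finset.range (M.numU i j),
          (p j * segAmt (M.l i j) k (y j) + γ j k * M.l i j k) := by
        rw [Finset.mul_sum]
        refine Finset.sum_le_sum fun k hk => ?_
        rw [Finset.mem_range] at hk
        have h1 := mul_le_mul_of_nonneg_right (hdual j k hk) (segAmt_nonneg (M.l i j) k (y j))
        have h2 := mul_le_mul_of_nonneg_left (segAmt_le (M.l i j) k (y j) (hl k hk)) (hγ j k hk)
        linarith
    _ ≤ _ := by
        rw [Finset.sum_add_distrib, ← Finset.mul_sum]
        gcongr
        exact hp j

/-- Equality in the Lagrangian bound under complementary slackness. -/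
lemma mul_segUtility_eq (i : M.A) {lam : ℝ} {p : M.G → ℝ} {q γ : M.G → ℕ → ℝ}
    (hp : ∀ j, 0 < p j)
    (hq : ∀ j k, k < M.numU i j → q j k * (M.u i j k * lam - p j - γ j k) = 0)
    (hγ : ∀ j k, k < M.numU i j → γ j k * (q j k - M.l i j k * p j) = 0) :
    lam * M.segUtility i (fun j k => q j k / p j)
      = ∑ j, ∑ k ∈ Finset.range (M.numU i j), q j k
        + ∑ j, ∑ k ∈ Finset.range (M.numU i j), γ j k * M.l i j k := by
  rw [segUtility, Finset.mul_sum, ← Finset.sum_add_distrib]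
  refine Finset.sum_congr rfl fun j _ => ?_
  rw [Finset.mul_sum, ← Finset.sum_add_distrib]
  refine Finset.sum_congr rfl fun k hk => ?_
  rw [Finset.mem_range] at hk
  have hpj := (hp j).ne'
  have h1 := hq j k hk
  have h2 := hγ j k hk
  field_simp
  linarith

lemma utilFn_le_of_bundleCost_nonpos (i : M.A) {p x y : M.G → ℝ} (hp : ∀ j, 0 < p j)
    (hx : ∀ j, 0 ≤ x j) (hy : ∀ j, 0 ≤ y j) (hcx : M.bundleCost p x ≤ 0)
    (hcy : M.bundleCost p y ≤ 0) : M.utilFn i y ≤ M.utilFn i x := by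
  have key : ∀ z : M.G → ℝ, (∀ j, 0 ≤ z j) → M.bundleCost p z ≤ 0 → z = 0 := by
    intro z hz hcz
    have hnn : ∀ j ∈ Finset.univ, 0 ≤ p j * z j := fun j _ => mul_nonneg (hp j).le (hz j)
    have h0 := (Finset.sum_eq_zero_iff_of_nonneg hnn).1 (le_antisymm hcz (Finset.sum_nonneg hnn))
    funext j
    exact (mul_eq_zero.1 (h0 j (Finset.mem_univ j))).resolve_left (hp j).ne'
  rw [key x hx hcx, key y hy hcy]

lemma budget_nonneg (i : M.A) {p : M.G → ℝ} {β : M.F → M.G → ℕ → ℝ} (hp : ∀ j, 0 ≤ p j)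
    (hβ : ∀ f j k, 0 ≤ β f j k) : 0 ≤ M.budget i p (M.lcpProfit β) :=
  add_nonneg (Finset.sum_nonneg fun j _ => mul_nonneg (M.w_nonneg i j) (hp j))
    (Finset.sum_nonneg fun f _ => mul_nonneg (M.θ_nonneg i f)
      (Finset.sum_nonneg fun j _ => Finset.sum_nonneg fun k hk =>
        mul_nonneg (M.o_pos f j k (Finset.mem_range.1 hk)).le (hβ f j k)))

end SPLCMarket

/-- At any solution of NHAD-LCP, each agent receives an optimal bundle at prices
`p = p' + c`: the bundle `x^i_j = ∑_k q^i_{jk}/(p'_j + c_j)` maximizes `U^i` among all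
bundles of cost at most `i`'s budget `∑_j w^i_j p_j + ∑_f θ^i_f E^f`. -/
theorem stmt7 (M : SPLCMarket) (hsafe : M.SafeLengths) (c : M.G → ℝ) (hc : M.GoodPriceLB c)
    (lam : M.A → ℝ) (p' : M.G → ℝ) (q γ : M.A → M.G → ℕ → ℝ) (r β : M.F → M.G → ℕ → ℝ)
    (hsol : M.NHADLCP c lam p' q γ r β) (i : M.A) :
    M.OptimalBundleAmt i (fun j => p' j + c j)
      (M.budget i (fun j => p' j + c j) (M.lcpProfit β))
      (fun j => (∑ k ∈ Finset.range (M.numU i j), q i j k) / (p' j + c j)) := by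
  obtain ⟨hp', hlam, hqγ, hrβ, -, -, -, hbud, hdual, hcap⟩ := hsol
  have hp : ∀ j, 0 < p' j + c j := fun j => by linarith [hp' j, hc.1 j]
  have hB := SPLCMarket.budget_nonneg i (p := fun j => p' j + c j) (fun j => (hp j).le)
    fun f j k => (hrβ f j k).2.1
  obtain ⟨hle, hslack⟩ := hbud i
  change M.budget i (fun j => p' j + c j) (M.lcpProfit β) - _ - 0 ≤ 0 at hle
  change lam i * (M.budget i (fun j => p' j + c j) (M.lcpProfit β) - _ - 0) = 0 at hslack
  generalize M.budget i (fun j => p' j + c j) (M.lcpProfit β) = B at hB hle hslack ⊢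
  have hx : ∀ j, 0 ≤ (∑ k ∈ Finset.range (M.numU i j), q i j k) / (p' j + c j) := fun j =>
    div_nonneg (Finset.sum_nonneg fun k _ => (hqγ i j k).1) (hp j).le
  have hcost : M.bundleCost (fun j => p' j + c j)
      (fun j => (∑ k ∈ Finset.range (M.numU i j), q i j k) / (p' j + c j))
      = ∑ j, ∑ k ∈ Finset.range (M.numU i j), q i j k :=
    Finset.sum_congr rfl fun j _ => mul_div_cancel₀ _ (hp j).ne'
  rcases (hlam i).eq_or_lt with h0 | hpos
  · have hq0 : ∑ j, ∑ k ∈ Finset.range (M.numU i j), q i j k = 0 := by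
      refine Finset.sum_eq_zero fun j _ => Finset.sum_eq_zero fun k hk => ?_
      refine (mul_eq_zero.1 (hdual i j k (Finset.mem_range.1 hk)).2).resolve_right ?_
      rw [← h0]
      linarith [hp j, (hqγ i j k).2.1]
    refine ⟨hx, by linarith, fun y hy hcy => ?_⟩
    exact SPLCMarket.utilFn_le_of_bundleCost_nonpos i hp hx hy (by linarith) (by linarith)
  · have hBq : B = ∑ j, ∑ k ∈ Finset.range (M.numU i j), q i j k := by
      linarith [(mul_eq_zero.1 hslack).resolve_left hpos.ne']
    refine ⟨hx, (hcost.trans hBq.symm).le, fun y hy hcy => le_of_mul_le_mul_left ?_ hpos⟩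
    have hub := SPLCMarket.mul_utilFn_le i (fun j => (hp j).le) hy
      (fun j k _ => (hqγ i j k).2.1) fun j k hk => (hdual i j k hk).1
    have heq := SPLCMarket.mul_segUtility_eq i hp (fun j k hk => (hdual i j k hk).2)
      fun j k hk => (hcap i j k hk).2
    have hgreedy := SPLCMarket.segUtility_le_utilFn i (fun j k => q i j k / (p' j + c j))
      (fun j k _ => div_nonneg (hqγ i j k).1 (hp j).le)
      fun j k hk => (div_le_iff₀ (hp j)).2 (hcap i j k hk).1
    simp only [← Finset.sum_div] at hgreedy
    have hmul := mul_le_mul_of_nonneg_left hgreedy hpos.le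
    linarith
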